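/- Let s ≥ 1 be a real number and let t ∈ [0, 1/2]. Then the inequality Q_{t,s}(a,b) < I(a,b) holds for all distinct positive real numbers a and b if and only if t ≤ 1/2 - (1/2)·√(1 - (2/e)^(2/s)). -/

import Mathlib

noncomputable def A (a b : ℝ) : ℝ := (a + b) / 2

noncomputable def G (a b : ℝ) : ℝ := Real.sqrt (a * b)

noncomputable def H (a b : ℝ) : ℝ := 2 * a * b / (a + b)

noncomputable def I (a b : ℝ) : ℝ :=
  (1 / Real.exp 1) * (a ^ a / b ^ b) ^ (1 / (a - b))

noncomputable def Q (t s a b : ℝ) : ℝ :=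
  G (t * a + (1 - t) * b) (t * b + (1 - t) * a) ^ s * A a b ^ (1 - s)

noncomputable def f (u s x : ℝ) : ℝ :=
  1 - (1 / (2 * x)) * Real.log ((1 + x) / (1 - x))
    - (1 / 2) * Real.log (1 - x ^ 2) + (s / 2) * Real.log (1 - u * x ^ 2)

noncomputable def h (u s x : ℝ) : ℝ :=
  -x + (1 / 2) * Real.log ((1 + x) / (1 - x)) - s * u * x ^ 3 / (1 - u * x ^ 2)

open Filter Topology

lemma hasSum_neg_f {u s x : ℝ} (hu0 : 0 ≤ u) (hu1 : u ≤ 1) (hx0 : 0 < x) (hx1 : x < 1) :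
    HasSum (fun k : ℕ => (s * u ^ (k + 1) * (2 * k + 3) - 1) * ((x ^ 2) ^ (k + 1) /
      (2 * (k + 1) * (2 * k + 3)))) (-f u s x) := by
  have hx2 : x ^ 2 < 1 := by nlinarith
  have hux : u * x ^ 2 < 1 := by nlinarith [sq_nonneg x]
  have h1 := Real.hasSum_log_sub_log_of_abs_lt_one (x := x) (by rwa [abs_of_pos hx0])
  have h2 := Real.hasSum_pow_div_log_of_abs_lt_one (x := x ^ 2)
    (by rwa [abs_of_nonneg (sq_nonneg x)])
  have h3 := Real.hasSum_pow_div_log_of_abs_lt_one (x := u * x ^ 2)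
    (by rwa [abs_of_nonneg (by positivity)])
  have h4 := ((hasSum_nat_add_iff' 1).2 (h1.mul_left (1 / (2 * x))))
  have h5 := (h4.sub (h2.mul_left (1 / 2))).add (h3.mul_left (s / 2))
  have hf : -f u s x = 1 / (2 * x) * (Real.log (1 + x) - Real.log (1 - x)) -
      ∑ i ∈ Finset.range 1, 1 / (2 * x) * (2 * (1 / (2 * (i : ℝ) + 1)) * x ^ (2 * i + 1)) -
        1 / 2 * -Real.log (1 - x ^ 2) + s / 2 * -Real.log (1 - u * x ^ 2) := by
    rw [f, Real.log_div (by linarith) (by linarith)]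
    simp
    field_simp
    ring
  rw [hf]
  refine (congrArg (HasSum · _) (funext fun k => ?_)).mpr h5
  have e : x ^ (2 * (k + 1) + 1) = (x ^ 2) ^ (k + 1) * x := by rw [pow_succ, pow_mul]
  have hk : 2 * ((k + 1 : ℕ) : ℝ) + 1 = 2 * k + 3 := by push_cast; ring
  rw [e, hk, mul_pow]
  generalize (x ^ 2) ^ (k + 1) = y
  generalize u ^ (k + 1) = z
  field_simp
  ring

lemma mul_pow_mul_lt_one_succ {u s : ℝ} (hu0 : 0 ≤ u) (hs : 1 ≤ s) (k : ℕ)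
    (hk : s * u ^ (k + 1) * (2 * k + 3) ≤ 1) : s * u ^ (k + 2) * (2 * k + 5) < 1 := by
  rcases hu0.eq_or_lt with rfl | hu
  · simp
  have hk0 : (0 : ℝ) ≤ k := k.cast_nonneg
  have hup : 0 < u ^ (k + 1) := by positivity
  have hlt : u * (2 * k + 5) < 2 * k + 3 := by
    by_contra! hcon
    have hle : (2 * k + 3) / (2 * k + 5) ≤ u := by
      rw [div_le_iff₀ (by positivity)]; exact hcon
    have hb := one_add_mul_le_pow (a := u - 1)
      (by linarith) (k + 1)
    have hv : 3 / (2 * (k : ℝ) + 5) ≤ 1 + ((k + 1 : ℕ) : ℝ) * (u - 1) := by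
      push_cast
      rw [div_le_iff₀ (by positivity)]
      nlinarith
    have hw : 3 / (2 * (k : ℝ) + 5) ≤ u ^ (k + 1) := by
      refine hv.trans (hb.trans_eq ?_)
      ring
    rw [div_le_iff₀ (by positivity)] at hw
    nlinarith [mul_nonneg hk0 hup.le, mul_le_mul_of_nonneg_right hs hup.le,
      mul_le_mul_of_nonneg_right (mul_le_mul_of_nonneg_right hs hup.le)
        (by positivity : 0 ≤ 2 * (k : ℝ) + 3)]
  calc s * u ^ (k + 2) * (2 * k + 5) = s * u ^ (k + 1) * (u * (2 * k + 5)) := by ring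
    _ < s * u ^ (k + 1) * (2 * k + 3) := by gcongr
    _ ≤ 1 := hk

lemma tendsto_f_one {u s : ℝ} (hu : u < 1) :
    Tendsto (f u s) (𝓝[<] 1) (𝓝 (1 - Real.log 2 + s / 2 * Real.log (1 - u))) := by
  have hc : ContinuousAt (fun x : ℝ => 1 - (1 / (2 * x)) * ((1 + x) * Real.log (1 + x) -
      (1 - x) * Real.log (1 - x)) + s / 2 * Real.log (1 - u * x ^ 2)) 1 := by
    have h1 : ContinuousAt (fun x : ℝ => (1 + x) * Real.log (1 + x)) 1 :=
      (Real.continuous_mul_log.comp (continuous_const.add continuous_id)).continuousAt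
    have h2 : ContinuousAt (fun x : ℝ => (1 - x) * Real.log (1 - x)) 1 :=
      (Real.continuous_mul_log.comp (continuous_const.sub continuous_id)).continuousAt
    have h3 : ContinuousAt (fun x : ℝ => Real.log (1 - u * x ^ 2)) 1 :=
      ContinuousAt.log (by fun_prop) (by simp; linarith)
    have h4 : ContinuousAt (fun x : ℝ => 1 / (2 * x)) 1 :=
      ContinuousAt.div (by fun_prop) (by fun_prop) (by norm_num)
    exact (continuousAt_const.sub (h4.mul (h1.sub h2))).add (continuousAt_const.mul h3)
  have ht := hc.tendsto.mono_left (nhdsWithin_le_nhds (s := Set.Iio 1))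
  have he : 1 - (1 / (2 * (1 : ℝ))) * ((1 + 1) * Real.log (1 + 1) -
      (1 - 1) * Real.log (1 - 1)) + s / 2 * Real.log (1 - u * 1 ^ 2) =
      1 - Real.log 2 + s / 2 * Real.log (1 - u) := by norm_num; ring
  rw [he] at ht
  refine ht.congr' ?_
  filter_upwards [Ioo_mem_nhdsLT (zero_lt_one (α := ℝ))] with x hx
  have hx0 : x ≠ 0 := hx.1.ne'
  have h1 : 1 + x ≠ 0 := by linarith [hx.1]
  have h2 : 1 - x ≠ 0 := by linarith [hx.2]
  rw [f, Real.log_div h1 h2, show 1 - x ^ 2 = (1 + x) * (1 - x) by ring, Real.log_mul h1 h2]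
  field_simp
  ring

lemma f_neg {u s : ℝ} (hu0 : 0 ≤ u) (hu1 : u ≤ 1) (hs : 1 ≤ s)
    (hus : u < 1 → s / 2 * Real.log (1 - u) ≤ Real.log 2 - 1) {x : ℝ} (hx0 : 0 < x)
    (hx1 : x < 1) : f u s x < 0 := by
  rw [← neg_pos]
  by_cases hall : ∀ k : ℕ, 1 ≤ s * u ^ (k + 1) * (2 * k + 3)
  · have hsum := hasSum_neg_f (s := s) hu0 hu1 hx0 hx1
    rw [← hsum.tsum_eq]
    refine hsum.summable.tsum_pos (fun k => ?_) 0 ?_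
    · exact mul_nonneg (by linarith [hall k]) (by positivity)
    · refine mul_pos ?_ (by positivity)
      by_contra! hcon
      have h1 := mul_pow_mul_lt_one_succ hu0 hs 0 (by linarith)
      have h2 := hall 1
      norm_num at h1 h2
      linarith
  push Not at hall
  classical
  obtain ⟨N, hN, hmin⟩ : ∃ N : ℕ, s * u ^ (N + 1) * (2 * N + 3) < 1 ∧
      ∀ k < N, 1 ≤ s * u ^ (k + 1) * (2 * k + 3) :=
    ⟨Nat.find hall, Nat.find_spec hall, fun k hk => not_lt.1 (Nat.find_min hall hk)⟩
  have hge : ∀ k, N ≤ k → s * u ^ (k + 1) * (2 * k + 3) < 1 := by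
    intro k hk
    induction k, hk using Nat.le_induction with
    | base => exact hN
    | succ k _ ih =>
      have := mul_pow_mul_lt_one_succ hu0 hs k ih.le
      push_cast
      convert this using 2
      ring
  have hu : u < 1 := by
    refine lt_of_le_of_ne hu1 ?_
    rintro rfl
    rw [one_pow] at hN
    nlinarith [N.cast_nonneg (α := ℝ)]
  have hcomp : ∀ y z : ℝ, 0 < y → y < z → z < 1 →
      (y ^ 2 / z ^ 2) ^ (N + 1) * (-f u s z) < -f u s y := by
    intro y z hy hyz hz
    have hz0 : 0 < z := hy.trans hyz
    have sy := hasSum_neg_f (s := s) hu0 hu1 hy (hyz.trans hz)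
    have sz := (hasSum_neg_f (s := s) hu0 hu1 hz0 hz).mul_left ((y ^ 2 / z ^ 2) ^ (N + 1))
    have hr0 : 0 < y ^ 2 / z ^ 2 := by positivity
    have hr1 : y ^ 2 / z ^ 2 < 1 := by
      rw [div_lt_one (by positivity)]; gcongr
    have hy2 : y ^ 2 = y ^ 2 / z ^ 2 * z ^ 2 := by field_simp
    have hterm : ∀ k : ℕ, ∀ c : ℝ, c * ((y ^ 2) ^ (k + 1) / (2 * (k + 1) * (2 * k + 3))) -
        (y ^ 2 / z ^ 2) ^ (N + 1) * (c * ((z ^ 2) ^ (k + 1) / (2 * (k + 1) * (2 * k + 3)))) =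
        (c * ((y ^ 2 / z ^ 2) ^ (k + 1) - (y ^ 2 / z ^ 2) ^ (N + 1))) *
          ((z ^ 2) ^ (k + 1) / (2 * (k + 1) * (2 * k + 3))) := by
      intro k c
      nth_rewrite 1 [hy2]
      rw [mul_pow]
      ring
    refine hasSum_lt (i := N + 1) (fun k => ?_) ?_ sz sy
    · beta_reduce
      rw [← sub_nonneg, hterm]
      refine mul_nonneg ?_ (by positivity)
      rcases lt_or_ge k N with hk | hk
      · exact mul_nonneg (by linarith [hmin k hk])
          (sub_nonneg.2 (pow_le_pow_of_le_one hr0.le hr1.le (by lia)))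
      · exact mul_nonneg_of_nonpos_of_nonpos (by linarith [hge k hk])
          (sub_nonpos.2 (pow_le_pow_of_le_one hr0.le hr1.le (by lia)))
    · rw [← sub_pos, hterm]
      refine mul_pos ?_ (by positivity)
      exact mul_pos_of_neg_of_neg (by linarith [hge (N + 1) (by lia)])
        (sub_neg.2 (pow_lt_pow_right_of_lt_one₀ hr0 hr1 (by lia)))
  have hnonneg : ∀ y : ℝ, 0 < y → y < 1 → 0 ≤ -f u s y := by
    intro y hy hy1
    have hl : Tendsto (fun z : ℝ => (y ^ 2 / z ^ 2) ^ (N + 1) * (-f u s z)) (𝓝[<] 1)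
        (𝓝 ((y ^ 2 / 1 ^ 2) ^ (N + 1) * (-(1 - Real.log 2 + s / 2 * Real.log (1 - u))))) := by
      refine Tendsto.mul ?_ (tendsto_f_one hu).neg
      have : ContinuousAt (fun z : ℝ => (y ^ 2 / z ^ 2) ^ (N + 1)) 1 :=
        (ContinuousAt.div (by fun_prop) (by fun_prop) (by norm_num)).pow _
      exact this.tendsto.mono_left nhdsWithin_le_nhds
    refine le_trans ?_ (le_of_tendsto hl (b := -f u s y) ?_)
    · exact mul_nonneg (by positivity) (by linarith [hus hu])
    · filter_upwards [Ioo_mem_nhdsLT hy1] with z hz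
      exact (hcomp y z hy hz.1 hz.2).le
  refine lt_of_le_of_lt ?_ (hcomp x ((x + 1) / 2) hx0 (by linarith) (by linarith))
  exact mul_nonneg (by positivity) (hnonneg _ (by linarith) (by linarith))

lemma Q_lt_I_iff_f_neg {s t m x : ℝ} (ht : t ∈ Set.Icc (0 : ℝ) (1 / 2)) (hm : 0 < m) (hx0 : 0 < x)
    (hx1 : x < 1) :
    Q t s (m * (1 + x)) (m * (1 - x)) < I (m * (1 + x)) (m * (1 - x)) ↔
      f ((1 - 2 * t) ^ 2) s x < 0 := by
  obtain ⟨ht0, ht1⟩ := ht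
  have h1 : 0 < 1 + x := by linarith
  have h2 : 0 < 1 - x := by linarith
  have hux : 0 < 1 - (1 - 2 * t) ^ 2 * x ^ 2 := by
    rw [← mul_pow]
    have : 0 ≤ (1 - 2 * t) * x := mul_nonneg (by linarith) hx0.le
    have : (1 - 2 * t) * x < 1 := by nlinarith
    nlinarith
  have hG : G (t * (m * (1 + x)) + (1 - t) * (m * (1 - x)))
      (t * (m * (1 - x)) + (1 - t) * (m * (1 + x))) =
      Real.sqrt (m ^ 2 * (1 - (1 - 2 * t) ^ 2 * x ^ 2)) := by
    rw [G]; congr 1; ring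
  have hA : A (m * (1 + x)) (m * (1 - x)) = m := by rw [A]; ring
  have hQ0 : 0 < Real.sqrt (m ^ 2 * (1 - (1 - 2 * t) ^ 2 * x ^ 2)) := by positivity
  have ha : 0 < m * (1 + x) := by positivity
  have hb : 0 < m * (1 - x) := by positivity
  have hpa := Real.rpow_pos_of_pos ha (m * (1 + x))
  have hpb := Real.rpow_pos_of_pos hb (m * (1 - x))
  have hlogQ : Real.log (Q t s (m * (1 + x)) (m * (1 - x))) =
      Real.log m + s / 2 * Real.log (1 - (1 - 2 * t) ^ 2 * x ^ 2) := by
    rw [Q, hG, hA, Real.log_mul (Real.rpow_pos_of_pos hQ0 _).ne' (Real.rpow_pos_of_pos hm _).ne',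
      Real.log_rpow hQ0, Real.log_rpow hm, Real.log_sqrt (by positivity),
      Real.log_mul (by positivity) hux.ne', Real.log_pow]
    push_cast
    ring
  have hlogI : Real.log (I (m * (1 + x)) (m * (1 - x))) = Real.log m - 1 +
      1 / (2 * x) * Real.log ((1 + x) / (1 - x)) + 1 / 2 * Real.log (1 - x ^ 2) := by
    rw [I, Real.log_mul (by positivity) (Real.rpow_pos_of_pos (div_pos hpa hpb) _).ne',
      Real.log_rpow (div_pos hpa hpb), Real.log_div hpa.ne' hpb.ne', Real.log_rpow ha,
      Real.log_rpow hb, one_div, Real.log_inv, Real.log_exp, Real.log_mul hm.ne' h1.ne',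
      Real.log_mul hm.ne' h2.ne', Real.log_div h1.ne' h2.ne',
      show 1 - x ^ 2 = (1 + x) * (1 - x) by ring, Real.log_mul h1.ne' h2.ne',
      show m * (1 + x) - m * (1 - x) = 2 * m * x by ring]
    field_simp
    ring
  have hQpos : 0 < Q t s (m * (1 + x)) (m * (1 - x)) := by
    rw [Q, hG, hA]; positivity
  have hIpos : 0 < I (m * (1 + x)) (m * (1 - x)) := by
    rw [I]; have := div_pos hpa hpb; positivity
  rw [← Real.log_lt_log_iff hQpos hIpos, hlogQ, hlogI, f]
  constructor <;> intro h <;> linarith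

lemma Q_comm (t s a b : ℝ) : Q t s a b = Q t s b a := by
  simp only [Q, G, A]
  rw [mul_comm (t * a + (1 - t) * b), add_comm a b]

lemma I_comm {a b : ℝ} (ha : 0 < a) (hb : 0 < b) : I a b = I b a := by
  have hpa := Real.rpow_pos_of_pos ha a
  have hpb := Real.rpow_pos_of_pos hb b
  rw [I, I, ← inv_div (b ^ b) (a ^ a), Real.inv_rpow (by positivity),
    ← Real.rpow_neg (by positivity), ← one_div_neg_eq_neg_one_div, neg_sub]

lemma forall_Q_lt_I_iff {s t : ℝ} (ht : t ∈ Set.Icc (0 : ℝ) (1 / 2)) :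
    (∀ a b : ℝ, 0 < a → 0 < b → a ≠ b → Q t s a b < I a b) ↔
      ∀ x : ℝ, 0 < x → x < 1 → f ((1 - 2 * t) ^ 2) s x < 0 := by
  constructor
  · intro h x hx0 hx1
    rw [← Q_lt_I_iff_f_neg ht one_pos hx0 hx1]
    exact h _ _ (by linarith) (by linarith) (by intro h; linarith)
  · intro h
    have key : ∀ a b : ℝ, 0 < a → 0 < b → b < a → Q t s a b < I a b := by
      intro a b ha hb hab
      have hx0 : 0 < (a - b) / (a + b) := div_pos (by linarith) (by linarith)
      have hx1 : (a - b) / (a + b) < 1 := by rw [div_lt_one (by linarith)]; linarith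
      have := (Q_lt_I_iff_f_neg (s := s) ht (half_pos (add_pos ha hb)) hx0 hx1).2 (h _ hx0 hx1)
      convert this using 2 <;> field_simp <;> ring
    intro a b ha hb hab
    rcases hab.lt_or_gt with hlt | hlt
    · rw [Q_comm, I_comm ha hb]
      exact key b a hb ha hlt
    · exact key a b ha hb hlt

lemma le_threshold_iff {s t : ℝ} (hs : 0 < s) (ht : t ∈ Set.Icc (0 : ℝ) (1 / 2)) :
    t ≤ 1 / 2 - (1 / 2) * Real.sqrt (1 - (2 / Real.exp 1) ^ ((2 : ℝ) / s)) ↔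
      ((1 - 2 * t) ^ 2 < 1 → s / 2 * Real.log (1 - (1 - 2 * t) ^ 2) ≤ Real.log 2 - 1) := by
  have h0 : t ≤ 1 / 2 - (1 / 2) * Real.sqrt (1 - (2 / Real.exp 1) ^ ((2 : ℝ) / s)) ↔
      1 - (1 - 2 * t) ^ 2 ≤ (2 / Real.exp 1) ^ ((2 : ℝ) / s) := by
    have : Real.sqrt (1 - (2 / Real.exp 1) ^ ((2 : ℝ) / s)) ≤ 1 - 2 * t ↔
        1 - (2 / Real.exp 1) ^ ((2 : ℝ) / s) ≤ (1 - 2 * t) ^ 2 :=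
      Real.sqrt_le_left (by linarith [ht.2])
    rw [sub_le_comm, ← this]
    constructor <;> intro h <;> linarith
  have hpos : 0 < (2 / Real.exp 1) ^ ((2 : ℝ) / s) := by positivity
  rw [h0]
  by_cases hu : (1 - 2 * t) ^ 2 < 1
  · rw [← Real.log_le_log_iff (by linarith) hpos, Real.log_rpow (by positivity),
      Real.log_div (by norm_num) (Real.exp_pos 1).ne', Real.log_exp, div_mul_eq_mul_div,
      le_div_iff₀ hs]
    constructor
    · intro h _
      linarith
    · intro h
      linarith [h hu]
  · exact ⟨fun _ h => absurd h hu, fun _ => by linarith⟩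

theorem stmt_0 (s t : ℝ) (hs : 1 ≤ s) (ht : t ∈ Set.Icc (0:ℝ) (1/2)) :
    (∀ a b : ℝ, 0 < a → 0 < b → a ≠ b → Q t s a b < I a b) ↔
      t ≤ 1/2 - (1/2) * Real.sqrt (1 - (2 / Real.exp 1) ^ ((2:ℝ)/s)) := by
  rw [forall_Q_lt_I_iff ht, le_threshold_iff (by linarith) ht]
  constructor
  · intro h hu
    have hle := le_of_tendsto (tendsto_f_one (s := s) hu) (b := 0) (by
      filter_upwards [Ioo_mem_nhdsLT (zero_lt_one (α := ℝ))] with x hx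
      exact (h x hx.1 hx.2).le)
    linarith
  · intro h x hx0 hx1
    exact f_neg (sq_nonneg _) (by nlinarith [ht.1, ht.2]) hs h hx0 hx1
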